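/- Let Ω ⊂ ℝⁿ be open bounded, α ∈ ((0,2]∩(0,n))\{1}, s = 1−α/2, Ã_α the Riesz kernel, and C: ℝⁿ → (fourth-order tensors) measurable with C̲|ε|² ≤ C(x)ε:ε ≤ C̄|ε|² uniformly for symmetric ε. Define a(u,u) = ∫_ℝⁿ C(x'') [∫_Ω Ã_{α/2}(|x''−x|)ε_u(x)dx] : [∫_Ω Ã_{α/2}(|x''−x'|)ε_u(x')dx'] dx''. Then for all u ∈ C_c^∞(Ω;ℝⁿ): C̲/2 · (u,u)_A ≤ a(u,u) ≤ C̄ · (u,u)_A, where (u,u)_A = ∫_Ω∫_Ω Ã_α(|x−x'|)∇u(x):∇u(x')dx'dx. -/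

import Mathlib

open MeasureTheory Real

noncomputable section

def jac {n : ℕ} (u : EuclideanSpace ℝ (Fin n) → EuclideanSpace ℝ (Fin n))
    (x : EuclideanSpace ℝ (Fin n)) : Matrix (Fin n) (Fin n) ℝ :=
  fun k m => fderiv ℝ u x (EuclideanSpace.single m 1) k

def symGrad {n : ℕ} (u : EuclideanSpace ℝ (Fin n) → EuclideanSpace ℝ (Fin n))
    (x : EuclideanSpace ℝ (Fin n)) : Matrix (Fin n) (Fin n) ℝ :=
  fun k m => (jac u x k m + jac u x m k) / 2

def frob {n : ℕ} (A B : Matrix (Fin n) (Fin n) ℝ) : ℝ := ∑ k, ∑ m, A k m * B k m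

def IsTestVF {n : ℕ} (Ω : Set (EuclideanSpace ℝ (Fin n)))
    (u : EuclideanSpace ℝ (Fin n) → EuclideanSpace ℝ (Fin n)) : Prop :=
  ContDiff ℝ (⊤ : ℕ∞) u ∧ HasCompactSupport u ∧ tsupport u ⊆ Ω

def rieszConst (n : ℕ) (α : ℝ) : ℝ :=
  π ^ ((n : ℝ) / 2) * (2 : ℝ) ^ α * Real.Gamma (α / 2) / Real.Gamma (((n : ℝ) - α) / 2)

def rieszKernel (n : ℕ) (α : ℝ) (x : EuclideanSpace ℝ (Fin n)) : ℝ :=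
  (rieszConst n α)⁻¹ * ‖x‖ ^ (α - (n : ℝ))

/-- The nonlocal strain `ε_u^{nl}(z) = ∫_Ω Ã_{α/2}(|z−x|) ε_u(x) dx` (componentwise). -/
def nlStrain {n : ℕ} (Ω : Set (EuclideanSpace ℝ (Fin n))) (α : ℝ)
    (u : EuclideanSpace ℝ (Fin n) → EuclideanSpace ℝ (Fin n))
    (z : EuclideanSpace ℝ (Fin n)) : Matrix (Fin n) (Fin n) ℝ :=
  fun k m => ∫ x in Ω, rieszKernel n (α / 2) (z - x) * symGrad u x k m

theorem lintegral_ofReal_of_integral_eq {X : Type*} [MeasurableSpace X] {μ : Measure X}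
    {f : X → ℝ} {c : ℝ} (hf : 0 ≤ᵐ[μ] f) (hc : 0 < c) (h : ∫ x, f x ∂μ = c) :
    ∫⁻ x, ENNReal.ofReal (f x) ∂μ = ENNReal.ofReal c := by
  rw [← h, ofReal_integral_eq_lintegral_ofReal (.of_integral_ne_zero (by rw [h]; exact hc.ne')) hf]

def heatKernel (n : ℕ) (t : ℝ) (x : EuclideanSpace ℝ (Fin n)) : ℝ :=
  (4 * π * t) ^ (-(n : ℝ) / 2) * rexp (-(‖x‖ ^ 2 / (4 * t)))

theorem heatKernel_nonneg {n : ℕ} {t : ℝ} (ht : 0 ≤ t) (x : EuclideanSpace ℝ (Fin n)) :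
    0 ≤ heatKernel n t x := by
  unfold heatKernel; positivity

theorem measurable_heatKernel (n : ℕ) :
    Measurable fun p : ℝ × EuclideanSpace ℝ (Fin n) => heatKernel n p.1 p.2 := by
  unfold heatKernel; fun_prop

theorem lintegral_heatKernel_mul {n : ℕ} {s t : ℝ} (hs : 0 < s) (ht : 0 < t)
    (x y : EuclideanSpace ℝ (Fin n)) :
    ∫⁻ z, ENNReal.ofReal (heatKernel n s (z - x) * heatKernel n t (z - y))
      = ENNReal.ofReal (heatKernel n (s + t) (x - y)) := by
  have hst : 0 < s + t := by positivity
  set c := (t / (s + t)) • x + (s / (s + t)) • y with hc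
  have hexp : ∀ z, -(‖z - x‖ ^ 2 / (4 * s)) + -(‖z - y‖ ^ 2 / (4 * t))
      = -(‖x - y‖ ^ 2 / (4 * (s + t))) + -((s + t) / (4 * s * t)) * ‖z - c‖ ^ 2 := by
    intro z
    have h1 : z - c = (t / (s + t)) • (z - x) + (s / (s + t)) • (z - y) := by
      have : z = (t / (s + t)) • z + (s / (s + t)) • z := by
        rw [← add_smul, ← add_div, add_comm t s, div_self hst.ne', one_smul]
      nth_rewrite 1 [this]
      rw [hc, smul_sub, smul_sub]; abel
    have h2 : x - y = (z - y) - (z - x) := by abel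
    rw [h1, h2]
    generalize z - x = v, z - y = w
    rw [norm_sub_sq_real, norm_add_sq_real, norm_smul, norm_smul, inner_smul_left,
      inner_smul_right, real_inner_comm, Real.norm_of_nonneg (by positivity),
      Real.norm_of_nonneg (by positivity)]
    simp only [conj_trivial]
    field_simp
    ring
  refine lintegral_ofReal_of_integral_eq (.of_forall fun z => mul_nonneg
    (heatKernel_nonneg hs.le _) (heatKernel_nonneg ht.le _)) (by unfold heatKernel; positivity) ?_
  have hprod : ∀ z, heatKernel n s (z - x) * heatKernel n t (z - y)
      = ((4 * π * s) ^ (-(n : ℝ) / 2) * (4 * π * t) ^ (-(n : ℝ) / 2)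
          * rexp (-(‖x - y‖ ^ 2 / (4 * (s + t)))))
        * rexp (-((s + t) / (4 * s * t)) * ‖z - c‖ ^ 2) := by
    intro z
    unfold heatKernel
    rw [mul_mul_mul_comm, ← Real.exp_add, hexp, Real.exp_add]
    ring
  simp_rw [hprod]
  rw [integral_const_mul,
    integral_sub_right_eq_self (fun z => rexp (-((s + t) / (4 * s * t)) * ‖z‖ ^ 2)) c,
    GaussianFourier.integral_rexp_neg_mul_sq_norm (by positivity), finrank_euclideanSpace_fin]
  unfold heatKernel
  have : (4 * π * s) ^ (-(n : ℝ) / 2) * (4 * π * t) ^ (-(n : ℝ) / 2)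
      * (π / ((s + t) / (4 * s * t))) ^ ((n : ℝ) / 2) = (4 * π * (s + t)) ^ (-(n : ℝ) / 2) := by
    rw [neg_div, Real.rpow_neg (by positivity), Real.rpow_neg (by positivity),
      Real.rpow_neg (by positivity), ← Real.inv_rpow (by positivity), ← Real.inv_rpow (by positivity),
      ← Real.inv_rpow (by positivity), ← Real.mul_rpow (by positivity) (by positivity),
      ← Real.mul_rpow (by positivity) (by positivity)]
    congr 1
    field_simp
  rw [← this]
  ring

theorem integral_rpow_mul_exp_neg_div_Ioi {a r : ℝ} (ha : 0 < a) (hr : 0 < r) :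
    ∫ t in Set.Ioi (0 : ℝ), t ^ (-a - 1) * rexp (-(r / t)) = (1 / r) ^ a * Real.Gamma a := by
  rw [← Real.integral_rpow_mul_exp_neg_mul_Ioi ha hr,
    ← integral_comp_rpow_Ioi _ (show (-1 : ℝ) ≠ 0 by norm_num)]
  refine setIntegral_congr_fun measurableSet_Ioi fun t (ht : 0 < t) => ?_
  simp only [abs_neg, abs_one, one_mul, smul_eq_mul]
  rw [← mul_assoc, ← Real.rpow_mul ht.le, ← Real.rpow_add ht, Real.rpow_neg_one, div_inv_eq_mul]
  congr 2
  ring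

theorem rieszConst_pos {n : ℕ} {α : ℝ} (hα0 : 0 < α) (hαn : α < n) : 0 < rieszConst n α := by
  have h1 : 0 < Real.Gamma (α / 2) := Real.Gamma_pos_of_pos (by positivity)
  have h2 : 0 < Real.Gamma ((n - α) / 2) := Real.Gamma_pos_of_pos (by linarith)
  unfold rieszConst; positivity

theorem rieszKernel_nonneg {n : ℕ} {α : ℝ} (hα0 : 0 < α) (hαn : α < n)
    (x : EuclideanSpace ℝ (Fin n)) : 0 ≤ rieszKernel n α x := by
  have := rieszConst_pos hα0 hαn
  unfold rieszKernel; positivity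

theorem measurable_rieszKernel (n : ℕ) (α : ℝ) : Measurable (rieszKernel n α) := by
  unfold rieszKernel; fun_prop

/-- The Riesz kernel is a superposition of heat kernels. -/
theorem ofReal_rieszKernel_eq_lintegral {n : ℕ} {α : ℝ} (hα0 : 0 < α) (hαn : α < n)
    {x : EuclideanSpace ℝ (Fin n)} (hx : x ≠ 0) :
    ENNReal.ofReal (rieszKernel n α x) = ∫⁻ t in Set.Ioi (0 : ℝ),
      ENNReal.ofReal ((Real.Gamma (α / 2))⁻¹ * t ^ (α / 2 - 1) * heatKernel n t x) := by
  have hx' : 0 < ‖x‖ := norm_pos_iff.mpr hx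
  have h1 : 0 < Real.Gamma (α / 2) := Real.Gamma_pos_of_pos (by positivity)
  have h2 : 0 < Real.Gamma ((n - α) / 2) := Real.Gamma_pos_of_pos (by linarith)
  have h3 := rieszConst_pos hα0 hαn
  symm
  refine lintegral_ofReal_of_integral_eq ?_ (by unfold rieszKernel; positivity) ?_
  · refine ae_restrict_of_forall_mem measurableSet_Ioi fun t (ht : 0 < t) => ?_
    have := heatKernel_nonneg ht.le x
    simp only [Pi.zero_apply]
    positivity
  · have : ∀ t ∈ Set.Ioi (0 : ℝ), (Real.Gamma (α / 2))⁻¹ * t ^ (α / 2 - 1) * heatKernel n t x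
        = ((Real.Gamma (α / 2))⁻¹ * (4 * π) ^ (-(n : ℝ) / 2))
          * (t ^ (-((n - α) / 2) - 1) * rexp (-((‖x‖ ^ 2 / 4) / t))) := by
      intro t (ht : 0 < t)
      unfold heatKernel
      rw [Real.mul_rpow (by positivity) ht.le,
        show -((n - α) / 2) - 1 = (α / 2 - 1) + -(n : ℝ) / 2 by ring, Real.rpow_add ht, div_div]
      ring
    rw [setIntegral_congr_fun measurableSet_Ioi this, integral_const_mul,
      integral_rpow_mul_exp_neg_div_Ioi (by linarith) (by positivity)]
    have e1 : (1 / (‖x‖ ^ 2 / 4)) ^ ((n - α) / 2) = 2 ^ (n - α) * ‖x‖ ^ (α - n) := by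
      rw [one_div_div, show (4 : ℝ) / ‖x‖ ^ 2 = (2 / ‖x‖) ^ (2 : ℝ) by
          rw [Real.rpow_two, div_pow]; norm_num,
        ← Real.rpow_mul (by positivity), Real.div_rpow (by positivity) (by positivity),
        div_eq_mul_inv, ← Real.rpow_neg (by positivity)]
      congr 2 <;> ring
    have e2 : (4 * π) ^ (-(n : ℝ) / 2) = (2 ^ (n : ℝ))⁻¹ * (π ^ ((n : ℝ) / 2))⁻¹ := by
      rw [Real.mul_rpow (by positivity) (by positivity), neg_div, Real.rpow_neg Real.pi_nonneg,
        show (4 : ℝ) = 2 ^ (2 : ℝ) by norm_num, ← Real.rpow_mul (by positivity),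
        show 2 * -((n : ℝ) / 2) = -n by ring, Real.rpow_neg (by positivity)]
    unfold rieszKernel rieszConst
    rw [e1, e2, Real.rpow_sub (by positivity)]
    field_simp

theorem integral_rpow_mul_sub_rpow {b τ : ℝ} (hb : 0 < b) (hτ : 0 < τ) :
    ∫ s in Set.Ioo 0 τ, s ^ (b - 1) * (τ - s) ^ (b - 1)
      = τ ^ (2 * b - 1) * (Real.Gamma b * Real.Gamma b / Real.Gamma (2 * b)) := by
  have h := Complex.betaIntegral_scaled b b hτ
  have h' : Complex.betaIntegral b b
      = ((Real.Gamma b * Real.Gamma b / Real.Gamma (2 * b) : ℝ) : ℂ) := by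
    rw [Complex.betaIntegral_eq_Gamma_mul_div _ _ (by simpa) (by simpa), two_mul,
      ← Complex.ofReal_add]
    simp only [Complex.Gamma_ofReal]
    push_cast
    rfl
  rw [h', intervalIntegral.integral_of_le hτ.le, integral_Ioc_eq_integral_Ioo] at h
  apply Complex.ofReal_injective
  rw [← integral_complex_ofReal, Complex.ofReal_mul, Complex.ofReal_cpow hτ.le]
  push_cast at h ⊢
  rw [two_mul, ← h]
  refine setIntegral_congr_fun measurableSet_Ioo fun s hs => ?_
  have h1 : 0 ≤ τ - s := by linarith [hs.2]
  rw [Complex.ofReal_cpow hs.1.le, Complex.ofReal_cpow h1]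
  push_cast
  rfl

theorem lintegral_lintegral_rpow_mul_comp_add {b : ℝ} (hb : 0 < b) {H : ℝ → ENNReal}
    (hH : Measurable H) :
    ∫⁻ s in Set.Ioi (0 : ℝ), ∫⁻ t in Set.Ioi (0 : ℝ),
        ENNReal.ofReal (s ^ (b - 1)) * ENNReal.ofReal (t ^ (b - 1)) * H (s + t)
      = ∫⁻ τ in Set.Ioi (0 : ℝ), ENNReal.ofReal
          (τ ^ (2 * b - 1) * (Real.Gamma b * Real.Gamma b / Real.Gamma (2 * b))) * H τ := by
  set w : ℝ → ENNReal := (Set.Ioi 0).indicator fun s => ENNReal.ofReal (s ^ (b - 1)) with hw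
  have hwm : Measurable w := Measurable.indicator (by fun_prop) measurableSet_Ioi
  have hwH : Measurable fun p : ℝ × ℝ => w p.1 * w (p.2 - p.1) * H p.2 := by fun_prop
  have h1 : ∫⁻ s in Set.Ioi (0 : ℝ), ∫⁻ t in Set.Ioi (0 : ℝ),
        ENNReal.ofReal (s ^ (b - 1)) * ENNReal.ofReal (t ^ (b - 1)) * H (s + t)
      = ∫⁻ s, ∫⁻ t, w s * w t * H (s + t) := by
    rw [← lintegral_indicator measurableSet_Ioi]
    refine lintegral_congr fun s => ?_
    by_cases hs : s ∈ Set.Ioi (0 : ℝ)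
    · rw [Set.indicator_of_mem hs, ← lintegral_indicator measurableSet_Ioi]
      refine lintegral_congr fun t => ?_
      by_cases ht : t ∈ Set.Ioi (0 : ℝ) <;> simp [hw, hs, ht]
    · simp [hw, hs]
  have h2 : ∀ s, ∫⁻ t, w s * w t * H (s + t) = ∫⁻ τ, w s * w (τ - s) * H τ := by
    intro s
    rw [← lintegral_sub_right_eq_self _ s]
    simp
  rw [h1, lintegral_congr h2, lintegral_lintegral_swap hwH.aemeasurable,
    ← lintegral_indicator measurableSet_Ioi]
  refine lintegral_congr fun τ => ?_
  by_cases hτ : τ ∈ Set.Ioi (0 : ℝ)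
  · have hτ' : 0 < τ := hτ
    have hG : 0 < Real.Gamma b := Real.Gamma_pos_of_pos hb
    have hG2 : 0 < Real.Gamma (2 * b) := Real.Gamma_pos_of_pos (by positivity)
    rw [Set.indicator_of_mem hτ, lintegral_mul_const _ (by fun_prop)]
    congr 1
    rw [← lintegral_ofReal_of_integral_eq _ (by positivity) (integral_rpow_mul_sub_rpow hb hτ'),
      ← lintegral_indicator measurableSet_Ioo]
    · refine lintegral_congr fun s => ?_
      by_cases hs : 0 < s
      · by_cases hs' : s < τ
        · rw [Set.indicator_of_mem (by exact ⟨hs, hs'⟩), ENNReal.ofReal_mul (by positivity)]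
          simp [hw, hs, hs']
        · simp [hw, hs']
      · simp [hw, hs]
    · refine ae_restrict_of_forall_mem measurableSet_Ioo fun s hs => ?_
      have h1 : 0 < τ - s := by linarith [hs.2]
      have h2 : 0 < s := hs.1
      simp only [Pi.zero_apply]
      positivity
  · rw [Set.indicator_of_notMem hτ]
    have : ∀ s, w s * w (τ - s) * H τ = 0 := by
      intro s
      by_cases hs : 0 < s
      · have : ¬ s < τ := by simp only [Set.mem_Ioi] at hτ; linarith
        simp [hw, this]
      · simp [hw, hs]
    simp [this]

/-- The semigroup property of the Riesz kernels. -/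
theorem lintegral_rieszKernel_mul_rieszKernel {n : ℕ} {β : ℝ} (hβ : 0 < β) (hβn : 2 * β < n)
    {x y : EuclideanSpace ℝ (Fin n)} (hxy : x ≠ y) :
    ∫⁻ z, ENNReal.ofReal (rieszKernel n β (z - x)) * ENNReal.ofReal (rieszKernel n β (z - y))
      = ENNReal.ofReal (rieszKernel n (2 * β) (x - y)) := by
  have hn : 0 < n := by
    have : (0 : ℝ) < n := by linarith
    exact_mod_cast this
  have : NeZero n := ⟨hn.ne'⟩
  have hG : 0 < Real.Gamma (β / 2) := Real.Gamma_pos_of_pos (by positivity)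
  have hG2 : 0 < Real.Gamma β := Real.Gamma_pos_of_pos (by positivity)
  have hm := measurable_heatKernel n
  set c : ENNReal := ENNReal.ofReal (Real.Gamma (β / 2))⁻¹
  set w : ℝ → ENNReal := fun s => ENNReal.ofReal (s ^ (β / 2 - 1)) with hw
  have hwm : Measurable w := by fun_prop
  set G : ℝ → EuclideanSpace ℝ (Fin n) → ENNReal :=
    fun t v => ENNReal.ofReal (heatKernel n t v) with hGdef
  have hGm : Measurable fun p : ℝ × EuclideanSpace ℝ (Fin n) => G p.1 p.2 := hm.ennreal_ofReal
  have hGm' : ∀ {X : Type} [MeasurableSpace X] {f : X → ℝ} {g : X → EuclideanSpace ℝ (Fin n)},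
      Measurable f → Measurable g → Measurable fun p => G (f p) (g p) :=
    fun hf hg => hGm.comp (hf.prodMk hg)
  have hK : ∀ v : EuclideanSpace ℝ (Fin n), v ≠ 0 → ENNReal.ofReal (rieszKernel n β v)
      = ∫⁻ t in Set.Ioi (0 : ℝ), c * w t * G t v := by
    intro v hv
    rw [ofReal_rieszKernel_eq_lintegral hβ (by linarith) hv]
    refine setLIntegral_congr_fun measurableSet_Ioi fun t (ht : 0 < t) => ?_
    rw [ENNReal.ofReal_mul (by positivity), ENNReal.ofReal_mul (by positivity)]
  have hae : ∀ a : EuclideanSpace ℝ (Fin n), ∀ᵐ z, z - a ≠ 0 := fun a => by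
    filter_upwards [compl_mem_ae_iff.mpr (measure_singleton a)] with z hz
    exact sub_ne_zero.mpr hz
  calc ∫⁻ z, ENNReal.ofReal (rieszKernel n β (z - x)) * ENNReal.ofReal (rieszKernel n β (z - y))
      = ∫⁻ z, ∫⁻ s in Set.Ioi (0 : ℝ), ∫⁻ t in Set.Ioi (0 : ℝ),
          (c * w s * G s (z - x)) * (c * w t * G t (z - y)) := by
        refine lintegral_congr_ae ?_
        filter_upwards [hae x, hae y] with z hx hy
        rw [hK _ hx, hK _ hy, lintegral_lintegral_mul]
        · exact ((hwm.const_mul c).mul (hGm' measurable_id measurable_const)).aemeasurable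
        · exact ((hwm.const_mul c).mul (hGm' measurable_id measurable_const)).aemeasurable
    _ = ∫⁻ s in Set.Ioi (0 : ℝ), ∫⁻ t in Set.Ioi (0 : ℝ), ∫⁻ z,
          (c * w s * G s (z - x)) * (c * w t * G t (z - y)) := by
        rw [lintegral_lintegral_swap]
        · refine lintegral_congr fun s => ?_
          rw [lintegral_lintegral_swap]
          refine Measurable.aemeasurable ?_
          refine Measurable.mul (.mul (by fun_prop) (hGm' (by fun_prop) (by fun_prop)))
            (.mul (by fun_prop) (hGm' (by fun_prop) (by fun_prop)))
        · refine Measurable.aemeasurable ?_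
          refine Measurable.lintegral_prod_right' (ν := volume.restrict (Set.Ioi 0))
            (f := fun p : (EuclideanSpace ℝ (Fin n) × ℝ) × ℝ =>
              (c * w p.1.2 * G p.1.2 (p.1.1 - x)) * (c * w p.2 * G p.2 (p.1.1 - y))) ?_
          refine Measurable.mul (.mul (by fun_prop) (hGm' (by fun_prop) (by fun_prop)))
            (.mul (by fun_prop) (hGm' (by fun_prop) (by fun_prop)))
    _ = ∫⁻ s in Set.Ioi (0 : ℝ), ∫⁻ t in Set.Ioi (0 : ℝ),
          w s * w t * (c * c * G (s + t) (x - y)) := by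
        refine setLIntegral_congr_fun measurableSet_Ioi fun s (hs : 0 < s) => ?_
        refine setLIntegral_congr_fun measurableSet_Ioi fun t (ht : 0 < t) => ?_
        have : ∀ z, (c * w s * G s (z - x)) * (c * w t * G t (z - y))
            = (w s * w t * (c * c))
              * ENNReal.ofReal (heatKernel n s (z - x) * heatKernel n t (z - y)) := by
          intro z
          rw [ENNReal.ofReal_mul (heatKernel_nonneg hs.le _)]
          ring
        simp only [this]
        rw [lintegral_const_mul' _ _ (by finiteness), lintegral_heatKernel_mul hs ht, mul_assoc]
    _ = _ := by
        have hHm : Measurable fun τ => c * c * G τ (x - y) :=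
          (hGm' measurable_id measurable_const).const_mul _
        rw [lintegral_lintegral_rpow_mul_comp_add (by positivity) hHm,
          ofReal_rieszKernel_eq_lintegral (by positivity) hβn (sub_ne_zero.mpr hxy)]
        refine setLIntegral_congr_fun measurableSet_Ioi fun t (ht : 0 < t) => ?_
        have := heatKernel_nonneg ht.le (x - y)
        simp only [c, hGdef]
        rw [← ENNReal.ofReal_mul (by positivity), ← ENNReal.ofReal_mul (by positivity),
          ← ENNReal.ofReal_mul (by positivity), mul_div_cancel_left₀ _ two_ne_zero]
        congr 1
        rw [mul_div_cancel₀ _ two_ne_zero]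
        field_simp

theorem integrableOn_rieszKernel_ball {n : ℕ} {α : ℝ} (hn : 0 < n) (hα : 0 < α) (r : ℝ) :
    IntegrableOn (rieszKernel n α) (Metric.ball 0 r) := by
  have : NeZero n := ⟨hn.ne'⟩
  have hfin := integrableOn_fun_norm_addHaar
    (volume : Measure (EuclideanSpace ℝ (Fin n))) (f := fun t : ℝ => t ^ (α - n)) (r := r)
  refine Integrable.const_mul (hfin.mpr ?_) _
  rcases le_or_gt r 0 with hr | hr
  · simp [Set.Ioo_eq_empty (not_lt.mpr hr)]
  have h : IntegrableOn (fun t : ℝ => t ^ (α - 1)) (Set.Ioo 0 r) := by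
    rw [← intervalIntegrable_iff_integrableOn_Ioo_of_le hr.le]
    exact intervalIntegral.intervalIntegrable_rpow' (by linarith)
  refine h.congr_fun (fun t ht => ?_) measurableSet_Ioo
  have ht0 : 0 < t := ht.1
  simp only [finrank_euclideanSpace_fin, smul_eq_mul]
  rw [← Real.rpow_natCast, ← Real.rpow_add ht0, Nat.cast_sub hn]
  congr 1
  push_cast
  ring

theorem integrable_rieszKernel_mul_mul {n : ℕ} {α : ℝ} (hα0 : 0 < α) (hαn : α < n)
    {f g : EuclideanSpace ℝ (Fin n) → ℝ} (hf : Continuous f) (hf' : HasCompactSupport f)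
    (hg : Continuous g) (hg' : HasCompactSupport g) :
    Integrable (fun p : EuclideanSpace ℝ (Fin n) × EuclideanSpace ℝ (Fin n) =>
      rieszKernel n α (p.1 - p.2) * (f p.1 * g p.2)) := by
  have hn : 0 < n := by
    have : (0 : ℝ) < n := by linarith
    exact_mod_cast this
  obtain ⟨M, hM⟩ := hf'.exists_bound_of_continuous hf
  obtain ⟨R, hR⟩ := (hf'.isCompact.isBounded.union hg'.isCompact.isBounded).subset_ball 0
  have hH : Integrable (fun p : EuclideanSpace ℝ (Fin n) × EuclideanSpace ℝ (Fin n) =>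
      (Metric.ball 0 (R + R)).indicator (rieszKernel n α) p.1 * ‖g p.2‖) (volume.prod volume) :=
    Integrable.mul_prod
      ((integrable_indicator_iff measurableSet_ball).mpr (integrableOn_rieszKernel_ball hn hα0 _))
      (hg.integrable_of_hasCompactSupport hg').norm
  have hS := (measurePreserving_sub_prod
    (volume : Measure (EuclideanSpace ℝ (Fin n))) volume).integrable_comp_of_integrable hH
  refine (hS.const_mul M).mono' ?_ (.of_forall fun p => ?_)
  · have := measurable_rieszKernel n α
    have hfm := hf.measurable
    have hgm := hg.measurable
    exact Measurable.aestronglyMeasurable (by fun_prop)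
  · have hK := rieszKernel_nonneg hα0 hαn (p.1 - p.2)
    have hM0 : 0 ≤ M := (norm_nonneg _).trans (hM p.1)
    simp only [Function.comp_apply]
    by_cases h : f p.1 = 0 ∨ g p.2 = 0
    · have : rieszKernel n α (p.1 - p.2) * (f p.1 * g p.2) = 0 := by
        rcases h with h | h <;> simp [h]
      rw [this, norm_zero]
      exact mul_nonneg hM0 (mul_nonneg
        (Set.indicator_nonneg (fun x _ => rieszKernel_nonneg hα0 hαn x) _) (norm_nonneg _))
    · push Not at h
      have h1 := hR (Or.inl (subset_tsupport f h.1))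
      have h2 := hR (Or.inr (subset_tsupport g h.2))
      rw [mem_ball_zero_iff] at h1 h2
      rw [Set.indicator_of_mem, norm_mul, norm_mul, Real.norm_of_nonneg hK]
      · calc _ = ‖f p.1‖ * (rieszKernel n α (p.1 - p.2) * ‖g p.2‖) := by ring
          _ ≤ _ := by gcongr; exact hM _
      · rw [mem_ball_zero_iff]
        exact (norm_sub_le _ _).trans_lt (add_lt_add h1 h2)

/-- The bilinear form `(f, g) ↦ ∬ Ã_α(|x - y|) f(x) g(y) dx dy` of the Riesz kernel. -/
def rieszForm {n : ℕ} (α : ℝ) (f g : EuclideanSpace ℝ (Fin n) → ℝ) : ℝ :=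
  ∫ p : EuclideanSpace ℝ (Fin n) × EuclideanSpace ℝ (Fin n),
    rieszKernel n α (p.1 - p.2) * (f p.1 * g p.2)

def rieszPotential {n : ℕ} (β : ℝ) (f : EuclideanSpace ℝ (Fin n) → ℝ)
    (z : EuclideanSpace ℝ (Fin n)) : ℝ :=
  ∫ x, rieszKernel n β (z - x) * f x

theorem measurable_rieszPotential {n : ℕ} (β : ℝ) {f : EuclideanSpace ℝ (Fin n) → ℝ}
    (hf : Measurable f) : Measurable (rieszPotential β f) := by
  have hK := measurable_rieszKernel n β
  refine StronglyMeasurable.measurable (StronglyMeasurable.integral_prod_right'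
    (f := fun p : EuclideanSpace ℝ (Fin n) × EuclideanSpace ℝ (Fin n) =>
      rieszKernel n β (p.1 - p.2) * f p.2) ?_)
  exact Measurable.stronglyMeasurable (by fun_prop)

theorem ae_prod_fst_ne_snd {n : ℕ} (hn : 0 < n) :
    ∀ᵐ p : EuclideanSpace ℝ (Fin n) × EuclideanSpace ℝ (Fin n), p.1 ≠ p.2 := by
  have : NeZero n := ⟨hn.ne'⟩
  have h0 : ∀ᵐ v : EuclideanSpace ℝ (Fin n), v ≠ 0 := compl_mem_ae_iff.mpr (measure_singleton 0)
  have h1 := (Measure.quasiMeasurePreserving_fst.comp (measurePreserving_sub_prod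
    (volume : Measure (EuclideanSpace ℝ (Fin n))) volume).quasiMeasurePreserving).ae h0
  exact h1.mono fun p hp => sub_ne_zero.mp hp

theorem integral_rieszKernel_mul_rieszKernel {n : ℕ} {β : ℝ} (hβ : 0 < β) (hβn : 2 * β < n)
    {x y : EuclideanSpace ℝ (Fin n)} (hxy : x ≠ y) :
    ∫ z, rieszKernel n β (z - x) * rieszKernel n β (z - y) = rieszKernel n (2 * β) (x - y) := by
  have hK := measurable_rieszKernel n β
  have hK0 := rieszKernel_nonneg (n := n) hβ (by linarith)
  rw [integral_eq_lintegral_of_nonneg_ae (.of_forall fun z => mul_nonneg (hK0 _) (hK0 _))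
    (Measurable.aestronglyMeasurable (by fun_prop))]
  simp_rw [ENNReal.ofReal_mul (hK0 _)]
  rw [lintegral_rieszKernel_mul_rieszKernel hβ hβn hxy,
    ENNReal.toReal_ofReal (rieszKernel_nonneg (by positivity) hβn _)]

theorem integrable_rieszKernel_triple {n : ℕ} {β : ℝ} (hβ : 0 < β) (hβn : 2 * β < n)
    {f g : EuclideanSpace ℝ (Fin n) → ℝ} (hf : Continuous f) (hf' : HasCompactSupport f)
    (hg : Continuous g) (hg' : HasCompactSupport g) :
    Integrable (fun q : EuclideanSpace ℝ (Fin n) ×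
        (EuclideanSpace ℝ (Fin n) × EuclideanSpace ℝ (Fin n)) =>
      (rieszKernel n β (q.1 - q.2.1) * f q.2.1) * (rieszKernel n β (q.1 - q.2.2) * g q.2.2))
      (volume.prod (volume.prod volume)) := by
  have hn : 0 < n := by
    have : (0 : ℝ) < n := by linarith
    exact_mod_cast this
  have hK := measurable_rieszKernel n β
  have hK0 := rieszKernel_nonneg (n := n) hβ (by linarith)
  have hfm := hf.measurable
  have hgm := hg.measurable
  refine ⟨Measurable.aestronglyMeasurable (by fun_prop), ?_⟩
  have hI := (integrable_rieszKernel_mul_mul (mul_pos two_pos hβ) hβn hf hf' hg hg').2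
  unfold HasFiniteIntegral at hI ⊢
  rw [lintegral_prod_symm' _ (by fun_prop)]
  refine lt_of_eq_of_lt (lintegral_congr_ae ?_) hI
  filter_upwards [ae_prod_fst_ne_snd hn] with p hp
  have : ∀ z, ‖rieszKernel n β (z - p.1) * f p.1 * (rieszKernel n β (z - p.2) * g p.2)‖ₑ
      = ENNReal.ofReal (rieszKernel n β (z - p.1)) * ENNReal.ofReal (rieszKernel n β (z - p.2))
        * (‖f p.1‖ₑ * ‖g p.2‖ₑ) := by
    intro z
    rw [enorm_mul, enorm_mul, enorm_mul, Real.enorm_of_nonneg (hK0 _), Real.enorm_of_nonneg (hK0 _)]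
    ring
  simp only [this]
  rw [lintegral_mul_const' _ _ (by finiteness), lintegral_rieszKernel_mul_rieszKernel hβ hβn hp,
    enorm_mul, enorm_mul, Real.enorm_of_nonneg (rieszKernel_nonneg (by positivity) hβn _)]

theorem integrable_rieszPotential_mul {n : ℕ} {β : ℝ} (hβ : 0 < β) (hβn : 2 * β < n)
    {f g : EuclideanSpace ℝ (Fin n) → ℝ} (hf : Continuous f) (hf' : HasCompactSupport f)
    (hg : Continuous g) (hg' : HasCompactSupport g) :
    Integrable fun z => rieszPotential β f z * rieszPotential β g z := by
  refine (integrable_rieszKernel_triple hβ hβn hf hf' hg hg').integral_prod_left.congr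
    (.of_forall fun z => ?_)
  exact integral_prod_mul (fun x => rieszKernel n β (z - x) * f x)
    (fun y => rieszKernel n β (z - y) * g y)

theorem integral_rieszPotential_mul {n : ℕ} {β : ℝ} (hβ : 0 < β) (hβn : 2 * β < n)
    {f g : EuclideanSpace ℝ (Fin n) → ℝ} (hf : Continuous f) (hf' : HasCompactSupport f)
    (hg : Continuous g) (hg' : HasCompactSupport g) :
    ∫ z, rieszPotential β f z * rieszPotential β g z = rieszForm (2 * β) f g := by
  have hn : 0 < n := by
    have : (0 : ℝ) < n := by linarith
    exact_mod_cast this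
  calc ∫ z, rieszPotential β f z * rieszPotential β g z
      = ∫ z, ∫ p : EuclideanSpace ℝ (Fin n) × EuclideanSpace ℝ (Fin n),
          (rieszKernel n β (z - p.1) * f p.1) * (rieszKernel n β (z - p.2) * g p.2)
            ∂(volume.prod volume) :=
        integral_congr_ae (.of_forall fun z => (integral_prod_mul
          (fun x => rieszKernel n β (z - x) * f x) (fun y => rieszKernel n β (z - y) * g y)).symm)
    _ = ∫ p : EuclideanSpace ℝ (Fin n) × EuclideanSpace ℝ (Fin n), ∫ z,
          (rieszKernel n β (z - p.1) * f p.1) * (rieszKernel n β (z - p.2) * g p.2)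
            ∂(volume : Measure (EuclideanSpace ℝ (Fin n))) ∂(volume.prod volume) :=
        integral_integral_swap (integrable_rieszKernel_triple hβ hβn hf hf' hg hg')
    _ = rieszForm (2 * β) f g := by
        refine integral_congr_ae ?_
        filter_upwards [ae_prod_fst_ne_snd hn] with p hp
        rw [← integral_rieszKernel_mul_rieszKernel hβ hβn hp, ← integral_mul_const]
        refine integral_congr_ae (.of_forall fun z => ?_)
        ring

theorem rieszForm_self_nonneg {n : ℕ} {α : ℝ} (hα0 : 0 < α) (hαn : α < n)
    {f : EuclideanSpace ℝ (Fin n) → ℝ} (hf : Continuous f) (hf' : HasCompactSupport f) :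
    0 ≤ rieszForm α f f := by
  have h := integral_rieszPotential_mul (β := α / 2) (by positivity) (by linarith) hf hf' hf hf'
  rw [mul_div_cancel₀ _ two_ne_zero] at h
  rw [← h]
  exact integral_nonneg fun z => mul_self_nonneg _

theorem rieszForm_half_add {n : ℕ} {α : ℝ} (hα0 : 0 < α) (hαn : α < n)
    {f g : EuclideanSpace ℝ (Fin n) → ℝ} (hf : Continuous f) (hf' : HasCompactSupport f)
    (hg : Continuous g) (hg' : HasCompactSupport g) :
    rieszForm α (fun x => (f x + g x) / 2) (fun x => (f x + g x) / 2)
      = (rieszForm α f f + rieszForm α f g + rieszForm α g f + rieszForm α g g) / 4 := by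
  have hff := integrable_rieszKernel_mul_mul hα0 hαn hf hf' hf hf'
  have hfg := integrable_rieszKernel_mul_mul hα0 hαn hf hf' hg hg'
  have hgf := integrable_rieszKernel_mul_mul hα0 hαn hg hg' hf hf'
  have hgg := integrable_rieszKernel_mul_mul hα0 hαn hg hg' hg hg'
  unfold rieszForm
  rw [← integral_add' hff hfg, ← integral_add' (hff.add hfg) hgf,
    ← integral_add' ((hff.add hfg).add hgf) hgg, ← integral_div]
  refine integral_congr_ae (.of_forall fun p => ?_)
  simp only [Pi.add_apply]
  ring

theorem rieszForm_neg_right {n : ℕ} (α : ℝ) (f g : EuclideanSpace ℝ (Fin n) → ℝ) :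
    rieszForm α f (fun x => -g x) = -rieszForm α f g := by
  simp [rieszForm, integral_neg]

theorem rieszForm_neg_left {n : ℕ} (α : ℝ) (f g : EuclideanSpace ℝ (Fin n) → ℝ) :
    rieszForm α (fun x => -f x) g = -rieszForm α f g := by
  simp [rieszForm, integral_neg]

theorem rieszForm_half_sub {n : ℕ} {α : ℝ} (hα0 : 0 < α) (hαn : α < n)
    {f g : EuclideanSpace ℝ (Fin n) → ℝ} (hf : Continuous f) (hf' : HasCompactSupport f)
    (hg : Continuous g) (hg' : HasCompactSupport g) :
    rieszForm α (fun x => (f x - g x) / 2) (fun x => (f x - g x) / 2)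
      = (rieszForm α f f - rieszForm α f g - rieszForm α g f + rieszForm α g g) / 4 := by
  have h := rieszForm_half_add hα0 hαn hf hf' hg.neg hg'.neg
  simp only [Pi.neg_apply, ← sub_eq_add_neg] at h
  rw [h, show (-g) = fun x => -g x from rfl]
  simp only [rieszForm_neg_right, rieszForm_neg_left]
  ring

theorem rieszForm_sum {n : ℕ} {α : ℝ} (hα0 : 0 < α) (hαn : α < n) {ι : Type*} [Fintype ι]
    {f : ι → EuclideanSpace ℝ (Fin n) → ℝ} (hf : ∀ i, Continuous (f i))
    (hf' : ∀ i, HasCompactSupport (f i)) :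
    rieszForm α (fun x => ∑ i, f i x) (fun x => ∑ i, f i x)
      = ∑ i, ∑ j, rieszForm α (f i) (f j) := by
  have hI := fun i j => integrable_rieszKernel_mul_mul hα0 hαn (hf i) (hf' i) (hf j) (hf' j)
  unfold rieszForm
  have : ∀ i, ∑ j, ∫ p : EuclideanSpace ℝ (Fin n) × EuclideanSpace ℝ (Fin n),
        rieszKernel n α (p.1 - p.2) * (f i p.1 * f j p.2)
      = ∫ p : EuclideanSpace ℝ (Fin n) × EuclideanSpace ℝ (Fin n),
        ∑ j, rieszKernel n α (p.1 - p.2) * (f i p.1 * f j p.2) :=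
    fun i => (integral_finsetSum _ fun j _ => hI i j).symm
  simp_rw [this]
  rw [← integral_finsetSum _ fun i _ => integrable_finsetSum _ fun j _ => hI i j]
  refine integral_congr_ae (.of_forall fun p => ?_)
  simp only [Finset.sum_mul_sum]
  simp only [Finset.mul_sum]

theorem integral_fderiv_mul_fderiv_swap {n : ℕ} {f g : EuclideanSpace ℝ (Fin n) → ℝ}
    (hf : ContDiff ℝ 2 f) (hf' : HasCompactSupport f) (hg : ContDiff ℝ 2 g)
    (v w : EuclideanSpace ℝ (Fin n)) :
    ∫ x, fderiv ℝ f x v * fderiv ℝ g x w = ∫ x, fderiv ℝ f x w * fderiv ℝ g x v := by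
  have hd : ∀ a, ContDiff ℝ 1 fun x => fderiv ℝ f x a := fun a =>
    (hf.fderiv_right (m := 1) (by norm_num)).clm_apply contDiff_const
  have hg1 : ∀ a, Continuous fun x => fderiv ℝ g x a := fun a =>
    (hg.continuous_fderiv (by norm_num)).clm_apply continuous_const
  have parts : ∀ a b, ∫ x, fderiv ℝ f x a * fderiv ℝ g x b
      = -∫ x, fderiv ℝ (fun y => fderiv ℝ f y a) x b * g x := by
    intro a b
    have hda : HasCompactSupport fun x => fderiv ℝ f x a := hf'.fderiv_apply ℝ a
    have hdd : Continuous fun x => fderiv ℝ (fun y => fderiv ℝ f y a) x b :=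
      ((hd a).continuous_fderiv (by norm_num)).clm_apply continuous_const
    exact integral_mul_fderiv_eq_neg_fderiv_mul_of_integrable
      ((hdd.mul hg.continuous).integrable_of_hasCompactSupport (hda.fderiv_apply ℝ b).mul_right)
      (((hd a).continuous.mul (hg1 b)).integrable_of_hasCompactSupport hda.mul_right)
      (((hd a).continuous.mul hg.continuous).integrable_of_hasCompactSupport hda.mul_right)
      (fun x _ => (hd a).differentiable (by norm_num) x)
      (fun x _ => hg.differentiable (by norm_num) x)
  have hsymm : ∀ x, fderiv ℝ (fun y => fderiv ℝ f y v) x w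
      = fderiv ℝ (fun y => fderiv ℝ f y w) x v := by
    intro x
    have hdf : DifferentiableAt ℝ (fderiv ℝ f) x :=
      (hf.fderiv_right (m := 1) (by norm_num)).differentiable (by norm_num) x
    rw [fderiv_clm_apply hdf (by fun_prop), fderiv_clm_apply hdf (by fun_prop)]
    simpa using hf.contDiffAt.isSymmSndFDerivAt (by simp) w v
  rw [parts v w, parts w v]
  simp_rw [hsymm]

theorem rieszForm_fderiv_swap {n : ℕ} {α : ℝ} (hα0 : 0 < α) (hαn : α < n)
    {f g : EuclideanSpace ℝ (Fin n) → ℝ} (hf : ContDiff ℝ 2 f) (hf' : HasCompactSupport f)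
    (hg : ContDiff ℝ 2 g) (hg' : HasCompactSupport g) (v w : EuclideanSpace ℝ (Fin n)) :
    rieszForm α (fun x => fderiv ℝ f x v) (fun x => fderiv ℝ g x w)
      = rieszForm α (fun x => fderiv ℝ f x w) (fun x => fderiv ℝ g x v) := by
  have hc : ∀ {h : EuclideanSpace ℝ (Fin n) → ℝ}, ContDiff ℝ 2 h → ∀ a,
      Continuous fun x => fderiv ℝ h x a := fun hh a =>
    (hh.continuous_fderiv (by norm_num)).clm_apply continuous_const
  have key : ∀ a b, rieszForm α (fun x => fderiv ℝ f x a) (fun x => fderiv ℝ g x b)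
      = ∫ z, rieszKernel n α z * ∫ y, fderiv ℝ f (z + y) a * fderiv ℝ g y b := by
    intro a b
    have hI := integrable_rieszKernel_mul_mul hα0 hαn (hc hf a) (hf'.fderiv_apply ℝ a)
      (hc hg b) (hg'.fderiv_apply ℝ b)
    have hmp := measurePreserving_add_prod (volume : Measure (EuclideanSpace ℝ (Fin n)))
      (volume : Measure (EuclideanSpace ℝ (Fin n)))
    have hI' := hmp.integrable_comp_of_integrable hI
    unfold rieszForm
    rw [Measure.volume_eq_prod, ← hmp.map_eq, integral_map hmp.measurable.aemeasurable
      (by rw [hmp.map_eq]; exact hI.aestronglyMeasurable)]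
    refine (integral_prod _ hI').trans (integral_congr_ae (.of_forall fun z => ?_))
    simp only [Function.comp_apply, add_sub_cancel_right]
    rw [integral_const_mul]
  rw [key, key]
  refine integral_congr_ae (.of_forall fun z => ?_)
  have h := integral_fderiv_mul_fderiv_swap (f := fun y => f (z + y)) (g := g)
    (hf.comp (contDiff_const.add contDiff_id)) (hf'.comp_homeomorph (Homeomorph.addLeft z)) hg v w
  simp only [fderiv_comp_add_left] at h
  simp only [h]

section TestVectorField

variable {n : ℕ} {Ω : Set (EuclideanSpace ℝ (Fin n))}
  {u : EuclideanSpace ℝ (Fin n) → EuclideanSpace ℝ (Fin n)}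

theorem IsTestVF.contDiff_apply (hu : IsTestVF Ω u) (k : Fin n) :
    ContDiff ℝ 2 fun x => u x k :=
  contDiff_infty.mp (contDiff_euclidean.mp hu.1 k) 2

theorem IsTestVF.hasCompactSupport_apply (hu : IsTestVF Ω u) (k : Fin n) :
    HasCompactSupport fun x => u x k :=
  hu.2.1.comp_left (g := fun v : EuclideanSpace ℝ (Fin n) => v k) rfl

theorem IsTestVF.jac_eq (hu : IsTestVF Ω u) (x : EuclideanSpace ℝ (Fin n)) (k m : Fin n) :
    jac u x k m = fderiv ℝ (fun y => u y k) x (EuclideanSpace.single m 1) := by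
  have hd : DifferentiableAt ℝ u x := hu.1.differentiable (by simp) x
  have := ((EuclideanSpace.proj (𝕜 := ℝ) k).hasFDerivAt.comp x hd.hasFDerivAt).fderiv
  change _ = fderiv ℝ ((EuclideanSpace.proj (𝕜 := ℝ) k) ∘ u) x _
  rw [this]
  rfl

theorem IsTestVF.continuous_jac (hu : IsTestVF Ω u) (k m : Fin n) :
    Continuous fun x => jac u x k m := by
  simp_rw [hu.jac_eq]
  exact ((hu.contDiff_apply k).continuous_fderiv (by norm_num)).clm_apply continuous_const

theorem IsTestVF.hasCompactSupport_jac (hu : IsTestVF Ω u) (k m : Fin n) :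
    HasCompactSupport fun x => jac u x k m := by
  simp_rw [hu.jac_eq]
  exact (hu.hasCompactSupport_apply k).fderiv_apply ℝ _

theorem IsTestVF.jac_eq_zero (hu : IsTestVF Ω u) {x : EuclideanSpace ℝ (Fin n)} (hx : x ∉ Ω) :
    jac u x = 0 := by
  ext k m
  have : fderiv ℝ u x = 0 := by
    by_contra h
    exact hx (hu.2.2 (support_fderiv_subset ℝ h))
  simp [jac, this]

theorem IsTestVF.continuous_symGrad (hu : IsTestVF Ω u) (k m : Fin n) :
    Continuous fun x => symGrad u x k m :=
  ((hu.continuous_jac k m).add (hu.continuous_jac m k)).div_const 2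

theorem IsTestVF.hasCompactSupport_symGrad (hu : IsTestVF Ω u) (k m : Fin n) :
    HasCompactSupport fun x => symGrad u x k m :=
  ((hu.hasCompactSupport_jac k m).add (hu.hasCompactSupport_jac m k)).comp_left
    (g := fun t : ℝ => t / 2) (zero_div 2)

theorem IsTestVF.nlStrain_eq (hu : IsTestVF Ω u) (α : ℝ) (z : EuclideanSpace ℝ (Fin n))
    (k m : Fin n) :
    nlStrain Ω α u z k m = rieszPotential (α / 2) (fun x => symGrad u x k m) z :=
  setIntegral_eq_integral_of_forall_compl_eq_zero fun x hx => by
    simp [symGrad, hu.jac_eq_zero hx]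

theorem nlStrain_transpose (α : ℝ) (z : EuclideanSpace ℝ (Fin n)) :
    (nlStrain Ω α u z).transpose = nlStrain Ω α u z := by
  ext k m
  simp [nlStrain, symGrad, add_comm]

theorem IsTestVF.integral_jac_eq (hu : IsTestVF Ω u) {α : ℝ} (hα0 : 0 < α) (hαn : α < n) :
    ∫ x in Ω, ∫ y in Ω, rieszKernel n α (x - y) * frob (jac u x) (jac u y)
      = ∑ k, ∑ m, rieszForm α (fun x => jac u x k m) (fun x => jac u x k m) := by
  have hI := fun k m => integrable_rieszKernel_mul_mul hα0 hαn (hu.continuous_jac k m)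
    (hu.hasCompactSupport_jac k m) (hu.continuous_jac k m) (hu.hasCompactSupport_jac k m)
  have hI2 : Integrable (fun p : EuclideanSpace ℝ (Fin n) × EuclideanSpace ℝ (Fin n) =>
      rieszKernel n α (p.1 - p.2) * frob (jac u p.1) (jac u p.2)) := by
    simp_rw [frob, Finset.mul_sum]
    exact integrable_finsetSum _ fun k _ => integrable_finsetSum _ fun m _ => hI k m
  calc ∫ x in Ω, ∫ y in Ω, rieszKernel n α (x - y) * frob (jac u x) (jac u y)
      = ∫ x, ∫ y, rieszKernel n α (x - y) * frob (jac u x) (jac u y) := by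
        rw [setIntegral_eq_integral_of_forall_compl_eq_zero]
        · refine integral_congr_ae (.of_forall fun x => ?_)
          exact setIntegral_eq_integral_of_forall_compl_eq_zero fun y hy => by
            simp [frob, hu.jac_eq_zero hy]
        · intro x hx
          simp [frob, hu.jac_eq_zero hx]
    _ = ∫ p : EuclideanSpace ℝ (Fin n) × EuclideanSpace ℝ (Fin n),
          rieszKernel n α (p.1 - p.2) * frob (jac u p.1) (jac u p.2) := (integral_prod _ hI2).symm
    _ = _ := by
        simp_rw [frob, Finset.mul_sum, rieszForm]
        rw [integral_finsetSum _ fun k _ => integrable_finsetSum _ fun m _ => hI k m]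
        exact Finset.sum_congr rfl fun k _ => integral_finsetSum _ fun m _ => hI k m

theorem IsTestVF.integrable_frob_nlStrain (hu : IsTestVF Ω u) {α : ℝ} (hα0 : 0 < α)
    (hαn : α < n) : Integrable fun z => frob (nlStrain Ω α u z) (nlStrain Ω α u z) := by
  simp_rw [frob, hu.nlStrain_eq]
  exact integrable_finsetSum _ fun k _ => integrable_finsetSum _ fun m _ =>
    integrable_rieszPotential_mul (by positivity) (by linarith) (hu.continuous_symGrad k m)
      (hu.hasCompactSupport_symGrad k m) (hu.continuous_symGrad k m)
      (hu.hasCompactSupport_symGrad k m)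

theorem IsTestVF.integral_frob_nlStrain (hu : IsTestVF Ω u) {α : ℝ} (hα0 : 0 < α)
    (hαn : α < n) : ∫ z, frob (nlStrain Ω α u z) (nlStrain Ω α u z)
      = ∑ k, ∑ m, rieszForm α (fun x => symGrad u x k m) (fun x => symGrad u x k m) := by
  have hI := fun k m => integrable_rieszPotential_mul (β := α / 2) (by positivity) (by linarith)
    (hu.continuous_symGrad k m) (hu.hasCompactSupport_symGrad k m) (hu.continuous_symGrad k m)
    (hu.hasCompactSupport_symGrad k m)
  have hQ := fun k m => integral_rieszPotential_mul (β := α / 2) (by positivity) (by linarith)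
    (hu.continuous_symGrad k m) (hu.hasCompactSupport_symGrad k m) (hu.continuous_symGrad k m)
    (hu.hasCompactSupport_symGrad k m)
  simp_rw [frob, hu.nlStrain_eq]
  rw [integral_finsetSum _ fun k _ => integrable_finsetSum _ fun m _ => hI k m]
  refine Finset.sum_congr rfl fun k _ => ?_
  rw [integral_finsetSum _ fun m _ => hI k m]
  refine Finset.sum_congr rfl fun m _ => ?_
  rw [hQ, mul_div_cancel₀ _ two_ne_zero]

/-- The cross term `∬ Ã_α ∇u(x) : ∇u(y)ᵀ` equals `∬ Ã_α div u(x) div u(y)`. -/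
theorem IsTestVF.sum_rieszForm_jac_transpose (hu : IsTestVF Ω u) {α : ℝ} (hα0 : 0 < α)
    (hαn : α < n) : ∑ k, ∑ m, rieszForm α (fun x => jac u x k m) (fun x => jac u x m k)
      = rieszForm α (fun x => ∑ k, jac u x k k) (fun x => ∑ k, jac u x k k) := by
  rw [rieszForm_sum hα0 hαn (fun k => hu.continuous_jac k k) fun k => hu.hasCompactSupport_jac k k]
  refine Finset.sum_congr rfl fun k _ => Finset.sum_congr rfl fun m _ => ?_
  simp_rw [hu.jac_eq]
  exact rieszForm_fderiv_swap hα0 hαn (hu.contDiff_apply k) (hu.hasCompactSupport_apply k)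
    (hu.contDiff_apply m) (hu.hasCompactSupport_apply m) _ _

theorem IsTestVF.sum_rieszForm_jac_transpose_nonneg (hu : IsTestVF Ω u) {α : ℝ} (hα0 : 0 < α)
    (hαn : α < n) :
    0 ≤ ∑ k, ∑ m, rieszForm α (fun x => jac u x k m) (fun x => jac u x m k) := by
  rw [hu.sum_rieszForm_jac_transpose hα0 hαn]
  refine rieszForm_self_nonneg hα0 hαn
    (continuous_finsetSum _ fun k _ => hu.continuous_jac k k) ?_
  refine hu.2.1.fderiv (𝕜 := ℝ) |>.mono fun x hx => ?_
  contrapose! hx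
  simp only [Function.mem_support, not_not] at hx ⊢
  simp [jac, hx]

theorem IsTestVF.sum_rieszForm_symGrad (hu : IsTestVF Ω u) {α : ℝ} (hα0 : 0 < α)
    (hαn : α < n) :
    ∑ k, ∑ m, rieszForm α (fun x => symGrad u x k m) (fun x => symGrad u x k m)
      = (∑ k, ∑ m, rieszForm α (fun x => jac u x k m) (fun x => jac u x k m)
        + ∑ k, ∑ m, rieszForm α (fun x => jac u x k m) (fun x => jac u x m k)) / 2 := by
  have h := fun k m => rieszForm_half_add hα0 hαn (hu.continuous_jac k m)
    (hu.hasCompactSupport_jac k m) (hu.continuous_jac m k) (hu.hasCompactSupport_jac m k)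
  simp_rw [symGrad, h, ← Finset.sum_div, Finset.sum_add_distrib]
  rw [Finset.sum_comm (f := fun k m => rieszForm α (fun x => jac u x m k) fun x => jac u x k m),
    Finset.sum_comm (f := fun k m => rieszForm α (fun x => jac u x m k) fun x => jac u x m k)]
  ring

theorem IsTestVF.sum_rieszForm_symGrad_le (hu : IsTestVF Ω u) {α : ℝ} (hα0 : 0 < α)
    (hαn : α < n) :
    ∑ k, ∑ m, rieszForm α (fun x => symGrad u x k m) (fun x => symGrad u x k m)
      ≤ ∑ k, ∑ m, rieszForm α (fun x => jac u x k m) (fun x => jac u x k m) := by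
  have h := fun k m => rieszForm_half_sub hα0 hαn (hu.continuous_jac k m)
    (hu.hasCompactSupport_jac k m) (hu.continuous_jac m k) (hu.hasCompactSupport_jac m k)
  have hpos : 0 ≤ ∑ k, ∑ m, rieszForm α (fun x => (jac u x k m - jac u x m k) / 2)
      (fun x => (jac u x k m - jac u x m k) / 2) :=
    Finset.sum_nonneg fun k _ => Finset.sum_nonneg fun m _ => rieszForm_self_nonneg hα0 hαn
      (((hu.continuous_jac k m).sub (hu.continuous_jac m k)).div_const 2)
      (((hu.hasCompactSupport_jac k m).sub (hu.hasCompactSupport_jac m k)).comp_left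
        (g := fun t : ℝ => t / 2) (zero_div 2))
  simp_rw [h, ← Finset.sum_div, Finset.sum_add_distrib, Finset.sum_sub_distrib] at hpos
  rw [Finset.sum_comm (f := fun k m => rieszForm α (fun x => jac u x m k) fun x => jac u x k m),
    Finset.sum_comm (f := fun k m => rieszForm α (fun x => jac u x m k) fun x => jac u x m k)]
    at hpos
  rw [hu.sum_rieszForm_symGrad hα0 hαn]
  linarith

theorem measurable_frob_map {C : EuclideanSpace ℝ (Fin n) →
      Matrix (Fin n) (Fin n) ℝ →ₗ[ℝ] Matrix (Fin n) (Fin n) ℝ}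
    (hC : ∀ (ε : Matrix (Fin n) (Fin n) ℝ) (k m : Fin n), Measurable fun x => C x ε k m)
    {S : EuclideanSpace ℝ (Fin n) → Matrix (Fin n) (Fin n) ℝ}
    (hS : ∀ k m, Measurable fun x => S x k m) :
    Measurable fun x => frob (C x (S x)) (S x) := by
  have hCS : ∀ x k m, C x (S x) k m
      = ∑ i, ∑ j, S x i j * C x (Matrix.single i j 1) k m := by
    intro x k m
    conv_lhs => rw [Matrix.matrix_eq_sum_single (S x)]
    simp only [map_sum, Matrix.sum_apply]
    refine Finset.sum_congr rfl fun i _ => Finset.sum_congr rfl fun j _ => ?_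
    have : Matrix.single i j (S x i j) = S x i j • Matrix.single i j (1 : ℝ) := by simp
    rw [this, map_smul]
    rfl
  simp_rw [frob, hCS]
  fun_prop

theorem frob_self_nonneg (A : Matrix (Fin n) (Fin n) ℝ) : 0 ≤ frob A A :=
  Finset.sum_nonneg fun k _ => Finset.sum_nonneg fun m _ => mul_self_nonneg (A k m)

theorem frob_one_one : frob (1 : Matrix (Fin n) (Fin n) ℝ) 1 = n := by
  simp [frob, Matrix.one_apply]

end TestVectorField

/-- Coercivity and boundedness of the heterogeneous Eringen bilinear form built from the
Riesz kernel: `C̲/2 (u,u)_A ≤ a(u,u) ≤ C̄ (u,u)_A`. -/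
theorem heterogeneous_riesz_form_coercive_and_bounded
    {n : ℕ} (Ω : Set (EuclideanSpace ℝ (Fin n)))
    (hΩo : IsOpen Ω) (hΩb : Bornology.IsBounded Ω)
    (α : ℝ) (hα0 : 0 < α) (hα2 : α ≤ 2) (hαn : α < n) (hα1 : α ≠ 1)
    -- the spatially varying stiffness tensor
    (C : EuclideanSpace ℝ (Fin n) →
      Matrix (Fin n) (Fin n) ℝ →ₗ[ℝ] Matrix (Fin n) (Fin n) ℝ)
    (hCmeas : ∀ (ε : Matrix (Fin n) (Fin n) ℝ) (k m : Fin n), Measurable fun x => C x ε k m)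
    (Cund Cbar : ℝ) (hCund : 0 < Cund)
    (hClb : ∀ x, ∀ ε : Matrix (Fin n) (Fin n) ℝ, ε.transpose = ε →
      Cund * frob ε ε ≤ frob (C x ε) ε)
    (hCub : ∀ x, ∀ ε : Matrix (Fin n) (Fin n) ℝ, ε.transpose = ε →
      frob (C x ε) ε ≤ Cbar * frob ε ε)
    (u : EuclideanSpace ℝ (Fin n) → EuclideanSpace ℝ (Fin n)) (hu : IsTestVF Ω u) :
    (Cund / 2) * (∫ x in Ω, ∫ y in Ω, rieszKernel n α (x - y) * frob (jac u x) (jac u y))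
        ≤ ∫ z : EuclideanSpace ℝ (Fin n),
            frob (C z (nlStrain Ω α u z)) (nlStrain Ω α u z)
      ∧ (∫ z : EuclideanSpace ℝ (Fin n),
            frob (C z (nlStrain Ω α u z)) (nlStrain Ω α u z))
        ≤ Cbar * ∫ x in Ω, ∫ y in Ω, rieszKernel n α (x - y) * frob (jac u x) (jac u y) := by
  have hn : (0 : ℝ) < n := hα0.trans hαn
  have hCC : Cund ≤ Cbar := by
    have h1 := (hClb 0 1 Matrix.transpose_one).trans (hCub 0 1 Matrix.transpose_one)
    rw [frob_one_one] at h1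
    exact le_of_mul_le_mul_right h1 hn
  have hS := hu.integrable_frob_nlStrain hα0 hαn
  have hSm : ∀ k m, Measurable fun z => nlStrain Ω α u z k m := by
    intro k m
    simp_rw [hu.nlStrain_eq]
    exact measurable_rieszPotential _ (hu.continuous_symGrad k m).measurable
  have hlb := fun z => hClb z (nlStrain Ω α u z) (nlStrain_transpose α z)
  have hub := fun z => hCub z (nlStrain Ω α u z) (nlStrain_transpose α z)
  have hCS : Integrable fun z => frob (C z (nlStrain Ω α u z)) (nlStrain Ω α u z) := by
    refine (hS.const_mul Cbar).mono' (measurable_frob_map hCmeas hSm).aestronglyMeasurable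
      (.of_forall fun z => ?_)
    rw [Real.norm_of_nonneg ((mul_nonneg hCund.le (frob_self_nonneg _)).trans (hlb z))]
    exact hub z
  have hlow := integral_mono (hS.const_mul Cund) hCS hlb
  have hupp := integral_mono hCS (hS.const_mul Cbar) hub
  rw [integral_const_mul, hu.integral_frob_nlStrain hα0 hαn] at hlow hupp
  rw [hu.integral_jac_eq hα0 hαn]
  constructor
  · refine le_trans ?_ hlow
    rw [hu.sum_rieszForm_symGrad hα0 hαn, div_mul_eq_mul_div, mul_div_assoc]
    have := hu.sum_rieszForm_jac_transpose_nonneg hα0 hαn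
    gcongr
    linarith
  · refine hupp.trans ?_
    have := hu.sum_rieszForm_symGrad_le hα0 hαn
    have hCbar : 0 ≤ Cbar := hCund.le.trans hCC
    gcongr
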